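/- Let H = (U,F) be a finite connected graph with at least two vertices and let f be a flow in H. Then λ₁(H) ≥ 1/ρ̄(f). -/

import Mathlib

open Real
open scoped Classical

noncomputable section

/-- Normalized Laplacian `I - D^{-1/2} A D^{-1/2}` of a finite graph. -/
def normLap {V : Type*} [Fintype V] [DecidableEq V] (G : SimpleGraph V) [DecidableRel G.Adj] :
    Matrix V V ℝ :=
  1 - Matrix.diagonal (fun v => ((G.degree v : ℝ)) ^ (-(1:ℝ)/2)) * G.adjMatrix ℝ *
      Matrix.diagonal (fun v => ((G.degree v : ℝ)) ^ (-(1:ℝ)/2))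

lemma normLap_isHermitian {V : Type*} [Fintype V] [DecidableEq V] (G : SimpleGraph V)
    [DecidableRel G.Adj] : (normLap G).IsHermitian := by
  unfold Matrix.IsHermitian
  ext i j
  simp only [normLap, Matrix.conjTranspose_apply, Matrix.sub_apply, Matrix.one_apply,
    Matrix.mul_diagonal, Matrix.diagonal_mul, SimpleGraph.adjMatrix_apply, star_trivial]
  have h1 : (if j = i then (1:ℝ) else 0) = (if i = j then 1 else 0) := by
    by_cases h : i = j
    · rw [if_pos h.symm, if_pos h]
    · rw [if_neg fun hh => h hh.symm, if_neg h]
  have h2 : (if G.Adj j i then (1:ℝ) else 0) = (if G.Adj i j then 1 else 0) := by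
    by_cases h : G.Adj i j
    · rw [if_pos h.symm, if_pos h]
    · rw [if_neg fun hh => h hh.symm, if_neg h]
  rw [h1, h2]; ring

/-- `λ₁`: the second smallest eigenvalue (with multiplicity) of the normalized Laplacian. -/
def lambda1 {V : Type*} [Finite V] (G : SimpleGraph V) : ℝ :=
  letI : Fintype V := Fintype.ofFinite V
  letI : DecidableEq V := Classical.decEq V
  letI : DecidableRel G.Adj := Classical.decRel _
  ((Finset.univ.val.map (normLap_isHermitian G).eigenvalues).sort (· ≤ ·)).getD 1 0

/-- Degree of a vertex. -/
def degV {V : Type*} (G : SimpleGraph V) (v : V) : ℕ := {u | G.Adj v u}.ncard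

/-- Total volume `vol(U)`: the sum of all degrees. -/
def volV {V : Type*} [Finite V] (G : SimpleGraph V) : ℝ := ∑ᶠ v : V, (degV G v : ℝ)

/-- A flow: a nonnegative function on oriented simple paths which, for all distinct `s, t`,
routes `d(s)·d(t)/vol(U)` units of flow from `s` to `t`. -/
def IsFlow {V : Type*} [Finite V] (G : SimpleGraph V)
    (f : ∀ s t : V, G.Path s t → ℝ) : Prop :=
  (∀ (s t : V) (q : G.Path s t), 0 ≤ f s t q) ∧
  ∀ s t : V, s ≠ t →
    (∑ᶠ q : G.Path s t, f s t q) = (degV G s : ℝ) * (degV G t : ℝ) / volV G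

/-- Elongated flow `f̄(e) = Σ_{q ∋ e} f(q)·|q|` through an oriented edge (dart) `e`. -/
def elong {V : Type*} [Finite V] (G : SimpleGraph V)
    (f : ∀ s t : V, G.Path s t → ℝ) (e : G.Dart) : ℝ :=
  ∑ᶠ s : V, ∑ᶠ t : V, ∑ᶠ q : G.Path s t,
    (if e ∈ (q : G.Walk s t).darts then f s t q * ((q : G.Walk s t).length : ℝ) else 0)

/-- `ρ̄(f)`: the maximum elongated flow over all oriented edges. -/
def rhoBar {V : Type*} [Finite V] (G : SimpleGraph V)
    (f : ∀ s t : V, G.Path s t → ℝ) : ℝ := ⨆ e : G.Dart, elong G f e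

/-- `{Q', Q''}`, with `Q''` the complement of `Q'`, is a path consistent partition of the set of
oriented simple paths: for distinct `s, t`, `Q'` contains a path from `s` to `t` iff `Q''`
contains no such path. -/
def PathConsistent {V : Type*} [Finite V] (G : SimpleGraph V)
    (Q : ∀ s t : V, Set (G.Path s t)) : Prop :=
  ∀ s t : V, s ≠ t → ((∃ q : G.Path s t, q ∈ Q s t) ↔ (∀ q : G.Path s t, q ∈ Q s t))

/-- A `Q̃`-flow: nonnegative, vanishing outside `Q̃`, and routing the full flow demand
`d(s)·d(t)/vol(U)` between all pairs `s ≠ t` joined by some path of `Q̃`. -/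
def IsSubFlow {V : Type*} [Finite V] (G : SimpleGraph V)
    (Q : ∀ s t : V, Set (G.Path s t)) (f : ∀ s t : V, G.Path s t → ℝ) : Prop :=
  (∀ (s t : V) (q : G.Path s t), 0 ≤ f s t q) ∧
  (∀ (s t : V) (q : G.Path s t), q ∉ Q s t → f s t q = 0) ∧
  ∀ s t : V, s ≠ t → (∃ q : G.Path s t, q ∈ Q s t) →
    (∑ᶠ q : G.Path s t, f s t q) = (degV G s : ℝ) * (degV G t : ℝ) / volV G

lemma aux_finite_path {V : Type*} [Finite V] (G : SimpleGraph V) (s t : V) :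
    Finite (G.Path s t) := by
  haveI := Fintype.ofFinite V
  let g : G.Path s t → {p : G.Walk s t // p.length < Fintype.card V} :=
    fun q => ⟨q.1, q.2.length_lt⟩
  refine Finite.of_injective g ?_
  intro a b h
  exact Subtype.ext (congrArg (fun x => x.1) h)

lemma aux_walk_sum {V : Type*} (G : SimpleGraph V) (φ : V → ℝ) {s t : V} (p : G.Walk s t) :
    φ s - φ t = (p.darts.map (fun e => φ e.fst - φ e.snd)).sum := by
  induction p with
  | nil => simp
  | cons h p ih => simp [← ih]

lemma aux_path_sq {V : Type*} (G : SimpleGraph V) [Fintype G.Dart] (φ : V → ℝ) {s t : V}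
    (p : G.Walk s t) (hp : p.IsPath) :
    (φ s - φ t) ^ 2 ≤
      ∑ e : G.Dart, if e ∈ p.darts then (p.length : ℝ) * (φ e.fst - φ e.snd) ^ 2 else 0 := by
  have hnd : p.darts.Nodup := SimpleGraph.Walk.darts_nodup_of_support_nodup hp.support_nodup
  rw [aux_walk_sum G φ p, ← List.sum_toFinset _ hnd]
  refine sq_sum_le_card_mul_sum_sq.trans (le_of_eq ?_)
  rw [List.toFinset_card_of_nodup hnd, SimpleGraph.Walk.length_darts, Finset.mul_sum,
    ← Finset.sum_filter]
  refine Finset.sum_congr ?_ (fun _ _ => rfl)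
  ext e; simp

lemma aux_flow {V : Type*} [Fintype V] (G : SimpleGraph V) [Fintype G.Dart]
    (f : ∀ s t : V, G.Path s t → ℝ) (hf : IsFlow G f) (φ : V → ℝ) :
    ∑ s : V, ∑ t : V, (degV G s : ℝ) * (degV G t : ℝ) / volV G * (φ s - φ t) ^ 2 ≤
      rhoBar G f * ∑ e : G.Dart, (φ e.fst - φ e.snd) ^ 2 := by
  haveI : ∀ s t, Fintype (G.Path s t) := fun s t =>
    haveI := aux_finite_path G s t
    Fintype.ofFinite _
  have h1 : ∀ s t : V, (degV G s : ℝ) * (degV G t : ℝ) / volV G * (φ s - φ t) ^ 2 ≤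
      ∑ q : G.Path s t, ∑ e : G.Dart,
        (if e ∈ (q : G.Walk s t).darts then f s t q * ((q : G.Walk s t).length : ℝ) else 0)
          * (φ e.fst - φ e.snd) ^ 2 := by
    intro s t
    have key : ∀ q : G.Path s t, f s t q * (φ s - φ t) ^ 2 ≤ ∑ e : G.Dart,
        (if e ∈ (q : G.Walk s t).darts then f s t q * ((q : G.Walk s t).length : ℝ) else 0)
          * (φ e.fst - φ e.snd) ^ 2 := by
      intro q
      refine (mul_le_mul_of_nonneg_left (aux_path_sq G φ q.1 q.2) (hf.1 s t q)).trans
        (le_of_eq ?_)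
      rw [Finset.mul_sum]
      refine Finset.sum_congr rfl fun e _ => ?_
      split_ifs <;> ring
    by_cases hst : s = t
    · subst hst
      simp only [sub_self, ne_eq, OfNat.ofNat_ne_zero, not_false_eq_true, zero_pow, mul_zero] at *
      exact Finset.sum_nonneg fun q _ => key q
    · rw [← hf.2 s t hst, finsum_eq_sum_of_fintype, Finset.sum_mul]
      exact Finset.sum_le_sum fun q _ => key q
  calc _ ≤ ∑ s : V, ∑ t : V, ∑ q : G.Path s t, ∑ e : G.Dart,
        (if e ∈ (q : G.Walk s t).darts then f s t q * ((q : G.Walk s t).length : ℝ) else 0)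
          * (φ e.fst - φ e.snd) ^ 2 :=
        Finset.sum_le_sum fun s _ => Finset.sum_le_sum fun t _ => h1 s t
    _ = ∑ e : G.Dart, elong G f e * (φ e.fst - φ e.snd) ^ 2 := by
        simp only [elong, finsum_eq_sum_of_fintype, Finset.sum_mul]
        rw [Finset.sum_comm]
        rw [Finset.sum_comm]
        conv_rhs => rw [Finset.sum_comm]
        refine Finset.sum_congr rfl fun s _ => ?_
        conv_rhs => rw [Finset.sum_comm]
        refine Finset.sum_congr rfl fun t _ => ?_
        rw [Finset.sum_comm]
    _ ≤ _ := by
        rw [Finset.mul_sum]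
        refine Finset.sum_le_sum fun e _ => mul_le_mul_of_nonneg_right ?_ (sq_nonneg _)
        exact le_ciSup (f := fun e => elong G f e) (Set.finite_range _).bddAbove e

lemma aux_dart_sum {V : Type*} [Fintype V] (G : SimpleGraph V) [Fintype G.Dart]
    [DecidableRel G.Adj] (F : V → V → ℝ) :
    ∑ e : G.Dart, F e.fst e.snd = ∑ u : V, ∑ v : V, if G.Adj u v then F u v else 0 := by
  rw [← Finset.sum_product', ← Finset.sum_filter]
  refine Finset.sum_bij (fun e _ => e.toProd) ?_ ?_ ?_ ?_
  · intro e _; simp [e.adj]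
  · intro a _ b _ h; exact SimpleGraph.Dart.ext _ _ h
  · intro b hb
    exact ⟨⟨b, by simpa using hb⟩, Finset.mem_univ _, rfl⟩
  · intro e _; rfl

lemma aux_degV {V : Type*} [Fintype V] (G : SimpleGraph V) [DecidableRel G.Adj] (v : V) :
    degV G v = G.degree v := by
  rw [degV, ← SimpleGraph.card_neighborSet_eq_degree, ← Nat.card_eq_fintype_card]
  rfl

lemma aux_deg_sum {V : Type*} [Fintype V] (G : SimpleGraph V) [DecidableRel G.Adj] (v : V) :
    ∑ u : V, (if G.Adj v u then (1:ℝ) else 0) = G.degree v := by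
  rw [← Finset.sum_filter, Finset.sum_const, nsmul_eq_mul, mul_one,
    ← SimpleGraph.card_neighborFinset_eq_degree, SimpleGraph.neighborFinset_eq_filter]

/-- Poincare inequality. -/
lemma aux_poincare {V : Type*} [Fintype V] (G : SimpleGraph V) [DecidableRel G.Adj]
    (hvol : 0 < ∑ v, (G.degree v : ℝ))
    (f : ∀ s t : V, G.Path s t → ℝ) (hf : IsFlow G f) (φ : V → ℝ)
    (h0 : ∑ v, (G.degree v : ℝ) * φ v = 0) :
    ∑ v, (G.degree v : ℝ) * φ v ^ 2 ≤ rhoBar G f *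
      (∑ v, (G.degree v : ℝ) * φ v ^ 2 - ∑ u, ∑ v, if G.Adj u v then φ u * φ v else 0) := by
  have h := aux_flow G f hf φ
  have hv : volV G = ∑ v, (G.degree v : ℝ) := by
    simp only [volV, finsum_eq_sum_of_fintype, aux_degV]
  have e1 : ∑ s : V, ∑ t : V, (degV G s : ℝ) * (degV G t : ℝ) / volV G * (φ s - φ t) ^ 2 =
      2 * ∑ v, (G.degree v : ℝ) * φ v ^ 2 := by
    rw [hv]
    simp only [aux_degV]
    set W := ∑ v, (G.degree v : ℝ) with hW
    have : ∀ s t : V, (G.degree s : ℝ) * (G.degree t : ℝ) / W * (φ s - φ t) ^ 2 =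
        W⁻¹ * (((G.degree s : ℝ) * φ s ^ 2) * (G.degree t : ℝ)
          + (G.degree s : ℝ) * ((G.degree t : ℝ) * φ t ^ 2)
          - 2 * (((G.degree s : ℝ) * φ s) * ((G.degree t : ℝ) * φ t))) := by
      intro s t; rw [div_eq_mul_inv]; ring
    simp only [this, ← Finset.mul_sum, Finset.sum_sub_distrib, Finset.sum_add_distrib, h0,
      ← Finset.sum_mul, ← hW]
    field_simp
    ring
  have e2 : ∑ e : G.Dart, (φ e.fst - φ e.snd) ^ 2 =
      2 * (∑ v, (G.degree v : ℝ) * φ v ^ 2 -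
        ∑ u, ∑ v, if G.Adj u v then φ u * φ v else 0) := by
    rw [aux_dart_sum G (fun u v => (φ u - φ v) ^ 2)]
    have : ∀ u v, (if G.Adj u v then (φ u - φ v) ^ 2 else 0) =
        φ u ^ 2 * (if G.Adj u v then (1:ℝ) else 0) + φ v ^ 2 * (if G.Adj u v then (1:ℝ) else 0)
          - 2 * (if G.Adj u v then φ u * φ v else 0) := by
      intro u v; split_ifs <;> ring
    simp only [this, ← Finset.mul_sum, Finset.sum_sub_distrib, Finset.sum_add_distrib]
    have h3 : ∑ u, ∑ v, φ v ^ 2 * (if G.Adj u v then (1:ℝ) else 0) =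
        ∑ v, (G.degree v : ℝ) * φ v ^ 2 := by
      rw [Finset.sum_comm]
      refine Finset.sum_congr rfl fun v _ => ?_
      rw [← Finset.mul_sum, ← aux_deg_sum, mul_comm]
      simp only [G.adj_comm]
    rw [h3]
    simp only [aux_deg_sum]
    simp only [mul_comm (φ _ ^ 2)]
    ring
  rw [e1, e2] at h
  linarith

lemma aux_normLap_quad {V : Type*} [Fintype V] [DecidableEq V] (G : SimpleGraph V)
    [DecidableRel G.Adj] (x : V → ℝ) :
    dotProduct x ((normLap G).mulVec x) = ∑ v, x v ^ 2 -
      ∑ u, ∑ v, if G.Adj u v then ((G.degree u : ℝ) ^ (-(1:ℝ)/2) * x u) *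
        ((G.degree v : ℝ) ^ (-(1:ℝ)/2) * x v) else 0 := by
  have : ∀ u v, normLap G u v = (1 : Matrix V V ℝ) u v - (G.degree u : ℝ) ^ (-(1:ℝ)/2) *
      (if G.Adj u v then 1 else 0) * (G.degree v : ℝ) ^ (-(1:ℝ)/2) := by
    intro u v
    simp only [normLap, Matrix.sub_apply, 
      Matrix.mul_diagonal, Matrix.diagonal_mul, SimpleGraph.adjMatrix_apply]
  simp only [dotProduct, Matrix.mulVec, this, sub_mul, Finset.sum_sub_distrib, mul_sub,
    Finset.mul_sum]
  congr 1
  · refine Finset.sum_congr rfl fun v _ => ?_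
    simp [Matrix.one_apply]; ring
  · refine Finset.sum_congr rfl fun u _ => Finset.sum_congr rfl fun v _ => ?_
    split_ifs <;> ring

lemma aux_sorted {ι : Type*} [Fintype ι] (h : 2 ≤ Fintype.card ι) (e : ι → ℝ) :
    ∃ i j, i ≠ j ∧ e i ≤ ((Finset.univ.val.map e).sort (· ≤ ·)).getD 1 0 ∧
      e j ≤ ((Finset.univ.val.map e).sort (· ≤ ·)).getD 1 0 := by
  have hs := Multiset.sort_eq (Finset.univ.val.map e) (· ≤ ·)
  have hp := Multiset.pairwise_sort (Finset.univ.val.map e) (· ≤ ·)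
  have hl : ((Finset.univ.val.map e).sort (· ≤ ·)).length = Fintype.card ι := by
    rw [Multiset.length_sort]; simp
  generalize (Finset.univ.val.map e).sort (· ≤ ·) = l at *
  match l, hs, hp, hl with
  | [], _, _, hl => simp at hl; omega
  | [_], _, _, hl => simp at hl; omega
  | x :: y :: r, hs, hp, _ =>
    have hs' : Finset.univ.val.map e = x ::ₘ y ::ₘ (r : Multiset ℝ) := hs.symm
    obtain ⟨i, _, hi, h2⟩ := (Multiset.map_eq_cons _ _ _ _).2 hs'
    obtain ⟨j, hj, hj', _⟩ := (Multiset.map_eq_cons _ _ _ _).2 h2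
    refine ⟨i, j, ?_, ?_, ?_⟩
    · rintro rfl
      exact Multiset.Nodup.notMem_erase Finset.univ.nodup hj
    · simp only [List.getD_cons_succ, List.getD_cons_zero, hi]
      simp at hp; exact hp.1.1
    · simp [hj']

lemma aux_two_dim {V : Type*} [Fintype V] [DecidableEq V] (A : Matrix V V ℝ)
    (hA : A.IsHermitian) (i j : V) (hij : i ≠ j) (c : ℝ) (hi : hA.eigenvalues i ≤ c)
    (hj : hA.eigenvalues j ≤ c) (w : V → ℝ) :
    ∃ x : V → ℝ, 0 < dotProduct x x ∧ dotProduct w x = 0 ∧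
      dotProduct x (A.mulVec x) ≤ c * dotProduct x x := by
  have hon := hA.eigenvectorBasis.orthonormal
  have mi := hA.mulVec_eigenvectorBasis i
  have mj := hA.mulVec_eigenvectorBasis j
  have ip : ∀ k l, dotProduct (hA.eigenvectorBasis k).ofLp (hA.eigenvectorBasis l).ofLp =
      if l = k then 1 else 0 := by
    intro k l
    rw [← orthonormal_iff_ite.1 hon l k, EuclideanSpace.inner_eq_star_dotProduct]
    simp
  have pii := ip i i
  have pij := ip i j
  have pji := ip j i
  have pjj := ip j j
  simp only [if_true, if_neg hij, if_neg hij.symm] at pii pij pji pjj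
  set a := (hA.eigenvectorBasis i).ofLp
  set b := (hA.eigenvectorBasis j).ofLp
  obtain ⟨α, β, hpos, hw⟩ : ∃ α β : ℝ, 0 < α ^ 2 + β ^ 2 ∧
      α * dotProduct w a + β * dotProduct w b = 0 := by
    by_cases h : dotProduct w a = 0
    · exact ⟨1, 0, by norm_num, by simp [h]⟩
    · refine ⟨dotProduct w b, - dotProduct w a, ?_, by ring⟩
      have : 0 < (dotProduct w a) ^ 2 := by positivity
      nlinarith [sq_nonneg (dotProduct w b)]
  refine ⟨α • a + β • b, ?_, ?_, ?_⟩
  · simp only [dotProduct_add, add_dotProduct, smul_dotProduct, dotProduct_smul, smul_eq_mul,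
      pii, pij, pji, pjj]
    nlinarith
  · simpa only [dotProduct_add, dotProduct_smul, smul_eq_mul] using hw
  · simp only [Matrix.mulVec_add, Matrix.mulVec_smul, mi, mj]
    simp only [dotProduct_add, add_dotProduct, smul_dotProduct, dotProduct_smul, smul_eq_mul,
      pii, pij, pji, pjj]
    nlinarith [mul_le_mul_of_nonneg_left hi (sq_nonneg α),
      mul_le_mul_of_nonneg_left hj (sq_nonneg β)]

lemma aux_core {V : Type*} [Fintype V] [DecidableEq V] (G : SimpleGraph V)
    [DecidableRel G.Adj] (hG : G.Connected)
    (hcard : 2 ≤ Fintype.card V) (f : ∀ s t : V, G.Path s t → ℝ) (hf : IsFlow G f) :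
    1 / rhoBar G f ≤
      ((Finset.univ.val.map (normLap_isHermitian G).eigenvalues).sort (· ≤ ·)).getD 1 0 := by
  obtain ⟨i, j, hij, hi, hj⟩ := aux_sorted hcard (normLap_isHermitian G).eigenvalues
  generalize ((Finset.univ.val.map (normLap_isHermitian G).eigenvalues).sort (· ≤ ·)).getD 1 0
    = c at *
  obtain ⟨x, hx, hw, hq⟩ := aux_two_dim _ (normLap_isHermitian G) i j hij c hi hj
    (fun v => (G.degree v : ℝ) * (G.degree v : ℝ) ^ (-(1:ℝ)/2))
  haveI : Nontrivial V := Fintype.one_lt_card_iff_nontrivial.1 (by omega)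
  have hd : ∀ v, 0 < (G.degree v : ℝ) := fun v => by
    exact_mod_cast hG.preconnected.degree_pos_of_nontrivial v
  have hvol : 0 < ∑ v, (G.degree v : ℝ) :=
    Finset.sum_pos (fun v _ => hd v) Finset.univ_nonempty
  have h0 : ∑ v, (G.degree v : ℝ) * ((G.degree v : ℝ) ^ (-(1:ℝ)/2) * x v) = 0 := by
    rw [← hw, dotProduct]
    exact Finset.sum_congr rfl fun v _ => by ring
  have hp := aux_poincare G hvol f hf (fun v => (G.degree v : ℝ) ^ (-(1:ℝ)/2) * x v) h0
  have hs : ∑ v, (G.degree v : ℝ) * ((G.degree v : ℝ) ^ (-(1:ℝ)/2) * x v) ^ 2 =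
      ∑ v, x v ^ 2 := by
    refine Finset.sum_congr rfl fun v _ => ?_
    have : ((G.degree v : ℝ) ^ (-(1:ℝ)/2)) ^ 2 = (G.degree v : ℝ)⁻¹ := by
      rw [← Real.rpow_natCast, ← Real.rpow_mul (hd v).le, ← Real.rpow_neg_one]
      norm_num
    rw [mul_pow, this, ← mul_assoc, mul_inv_cancel₀ (hd v).ne', one_mul]
  have hxx : dotProduct x x = ∑ v, x v ^ 2 :=
    Finset.sum_congr rfl fun v _ => by ring
  rw [hs, ← aux_normLap_quad, ← hxx] at hp
  have hρ : 0 ≤ rhoBar G f := by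
    refine Real.iSup_nonneg fun e => ?_
    refine finsum_nonneg fun s => finsum_nonneg fun t => finsum_nonneg fun q => ?_
    split_ifs
    · exact mul_nonneg (hf.1 s t q) (Nat.cast_nonneg _)
    · exact le_rfl
  have hρ' : 0 < rhoBar G f := by
    rcases hρ.eq_or_lt with h | h
    · rw [← h] at hp; linarith
    · exact h
  rw [div_le_iff₀ hρ']
  have := mul_le_mul_of_nonneg_left hq hρ
  nlinarith

/-- Sinclair. For a flow `f` in a finite connected graph `H` with at least
two vertices, `λ₁(H) ≥ 1/ρ̄(f)`. -/
theorem stmt_6 {V : Type*} [Fintype V] (G : SimpleGraph V) (hG : G.Connected)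
    (hcard : 2 ≤ Fintype.card V) (f : ∀ s t : V, G.Path s t → ℝ) (hf : IsFlow G f) :
    1 / rhoBar G f ≤ lambda1 G := by
  unfold lambda1
  refine @aux_core V (Fintype.ofFinite V) (Classical.decEq V) G (Classical.decRel _) hG ?_ f hf
  exact hcard.trans (le_of_eq (by congr 1; exact Subsingleton.elim _ _))

end
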